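/- Let X be a nonempty finite type and p a strictly positive probability mass function on X. Regarding the entropy H(β) = −Σ_x P_β(x)·log P_β(x) of the canonical distribution P_β(x) = p(x)^β / Z(β) as a function of β > 0, one has H'(β) = −β·(⟨ε²⟩_β − ⟨ε⟩_β²) ≤ 0, where ε(x) = −log p(x) and ⟨f⟩_β = Σ_x P_β(x)·f(x); consequently H is antitone (nonincreasing) on (0, ∞). -/

import Mathlib

open Real Finset

/-- Along the canonical family, the entropy
`H(β) = -Σ_x P_β(x)·log P_β(x)` satisfies
`H'(β) = -β·(⟨ε²⟩_β − ⟨ε⟩_β²) ≤ 0` for every `β > 0`, where `ε(x) = -log p(x)`;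
consequently `H` is antitone (nonincreasing) on `(0, ∞)`. -/
theorem stmt_14 {X : Type*} [Fintype X] [Nonempty X]
    (p : X → ℝ) (hp : ∀ x, 0 < p x) (hp1 : ∑ x, p x = 1)
    (H : ℝ → ℝ)
    (hH : H = fun β => -∑ x, (p x ^ β / ∑ x', p x' ^ β)
        * Real.log (p x ^ β / ∑ x', p x' ^ β)) :
    (∀ β : ℝ, 0 < β →
      deriv H β
        = -β * ((∑ x, (p x ^ β / ∑ x', p x' ^ β) * (-Real.log (p x)) ^ 2)
            - (∑ x, (p x ^ β / ∑ x', p x' ^ β) * (-Real.log (p x))) ^ 2)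
      ∧ deriv H β ≤ 0) ∧
    AntitoneOn H (Set.Ioi 0) := by
  have hZ : ∀ β : ℝ, 0 < ∑ x, p x ^ β := fun β =>
    Finset.sum_pos (fun x _ => Real.rpow_pos_of_pos (hp x) β) Finset.univ_nonempty
  have hH2 : H = fun β => Real.log (∑ x, p x ^ β)
      - β * ((∑ x, p x ^ β * Real.log (p x)) / ∑ x, p x ^ β) := by
    rw [hH]
    funext β
    have hz := (hZ β).ne'
    have h1 : ∀ x, (p x ^ β / ∑ x', p x' ^ β) * Real.log (p x ^ β / ∑ x', p x' ^ β)
        = β * ((p x ^ β * Real.log (p x)) / ∑ x', p x' ^ β)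
          - (p x ^ β / ∑ x', p x' ^ β) * Real.log (∑ x', p x' ^ β) := by
      intro x
      rw [Real.log_div (Real.rpow_pos_of_pos (hp x) β).ne' hz, Real.log_rpow (hp x)]
      ring
    rw [Finset.sum_congr rfl (fun x _ => h1 x), Finset.sum_sub_distrib, ← Finset.mul_sum,
      ← Finset.sum_div, ← Finset.sum_mul, ← Finset.sum_div, div_self hz]
    ring
  have hdp : ∀ (β : ℝ) x, HasDerivAt (fun b : ℝ => p x ^ b) (p x ^ β * Real.log (p x)) β :=
    fun β x => (Real.hasStrictDerivAt_const_rpow (hp x) β).hasDerivAt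
  have hdZ : ∀ β : ℝ, HasDerivAt (fun b : ℝ => ∑ x, p x ^ b)
      (∑ x, p x ^ β * Real.log (p x)) β := fun β =>
    HasDerivAt.fun_sum (fun x _ => hdp β x)
  have hdA : ∀ β : ℝ, HasDerivAt (fun b : ℝ => ∑ x, p x ^ b * Real.log (p x))
      (∑ x, p x ^ β * Real.log (p x) * Real.log (p x)) β := fun β =>
    HasDerivAt.fun_sum (fun x _ => (hdp β x).mul_const _)
  have hd : ∀ β : ℝ, HasDerivAt H
      (-β * ((∑ x, (p x ^ β / ∑ x', p x' ^ β) * (-Real.log (p x)) ^ 2)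
            - (∑ x, (p x ^ β / ∑ x', p x' ^ β) * (-Real.log (p x))) ^ 2)) β := by
    intro β
    have hz := (hZ β).ne'
    have h := ((hdZ β).log hz).sub ((hasDerivAt_id β).mul ((hdA β).div (hdZ β) hz))
    rw [hH2]
    refine h.congr_deriv ?_
    have e1 : (∑ x, (p x ^ β / ∑ x', p x' ^ β) * (-Real.log (p x)) ^ 2)
        = (∑ x, p x ^ β * Real.log (p x) * Real.log (p x)) / ∑ x', p x' ^ β := by
      rw [Finset.sum_div]
      exact Finset.sum_congr rfl fun x _ => by ring
    have e2 : (∑ x, (p x ^ β / ∑ x', p x' ^ β) * (-Real.log (p x)))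
        = -((∑ x, p x ^ β * Real.log (p x)) / ∑ x', p x' ^ β) := by
      rw [Finset.sum_div, ← Finset.sum_neg_distrib]
      exact Finset.sum_congr rfl fun x _ => by ring
    rw [e1, e2]
    simp only [id, Pi.div_apply]
    field_simp
    ring
  have hneg : ∀ β : ℝ, 0 < β →
      -β * ((∑ x, (p x ^ β / ∑ x', p x' ^ β) * (-Real.log (p x)) ^ 2)
            - (∑ x, (p x ^ β / ∑ x', p x' ^ β) * (-Real.log (p x))) ^ 2) ≤ 0 := by
    intro β hβ
    have hw : ∀ x, 0 ≤ p x ^ β / ∑ x', p x' ^ β := fun x =>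
      div_nonneg (Real.rpow_pos_of_pos (hp x) β).le (hZ β).le
    have hcs := Finset.sum_sq_le_sum_mul_sum_of_sq_eq_mul Finset.univ
      (r := fun x => (p x ^ β / ∑ x', p x' ^ β) * (-Real.log (p x)))
      (f := fun x => p x ^ β / ∑ x', p x' ^ β)
      (g := fun x => (p x ^ β / ∑ x', p x' ^ β) * (-Real.log (p x)) ^ 2)
      (fun x _ => hw x) (fun x _ => mul_nonneg (hw x) (sq_nonneg _)) (fun x _ => by ring)
    rw [← Finset.sum_div, div_self (hZ β).ne', one_mul] at hcs
    exact mul_nonpos_of_nonpos_of_nonneg (by linarith) (sub_nonneg.mpr hcs)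
  refine ⟨fun β hβ => ⟨(hd β).deriv, ?_⟩, ?_⟩
  · rw [(hd β).deriv]
    exact hneg β hβ
  · refine antitoneOn_of_deriv_nonpos (convex_Ioi 0)
      (fun β _ => (hd β).continuousAt.continuousWithinAt)
      (fun β _ => (hd β).differentiableAt.differentiableWithinAt) ?_
    intro β hβ
    rw [interior_Ioi] at hβ
    rw [(hd β).deriv]
    exact hneg β hβ
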